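/- arXiv:1812.11718 — 2 statements merged into one kernel-verified Lean document; each statement's English description precedes it below -/
import Mathlib

section
/- Suppose for each d ∈ D̂, the map φ(t; ·, d) : I₀ → Ω(t; I₀, d) is a homeomorphism onto its image. If x₀ ∈ ∂I₀ (the boundary of I₀), then for every d ∈ D̂, φ(t; x₀, d) does not belong to the interior of Ω₂(t; I₀). -/
namespace InvDom

open Set Metric MeasureTheory Topology

theorem det_zero {n : ℕ} {r : EuclideanSpace ℝ (Fin n) → EuclideanSpace ℝ (Fin n)} {R : ℝ}
    (hR : 0 < R) (hd : Differentiable ℝ r) (hn : ∀ x, ‖r x‖ = R) (x) :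
    (fderiv ℝ r x).det = 0 := by
  by_contra hdet
  have h1 : ∀ v, inner ℝ (r x) (fderiv ℝ r x v) = 0 := by
    intro v
    have h2 : HasFDerivAt (fun y => ‖r y‖ ^ 2) _ x := (hd x).hasFDerivAt.norm_sq
    have h3 : HasFDerivAt (fun y => ‖r y‖ ^ 2) (0 : EuclideanSpace ℝ (Fin n) →L[ℝ] ℝ) x := by
      simp only [hn]; exact hasFDerivAt_const _ _
    have h4 := congrArg (fun L => L v) (h2.unique h3)
    simpa using h4
  have hu : IsUnit (LinearMap.det (fderiv ℝ r x : EuclideanSpace ℝ (Fin n) →ₗ[ℝ] EuclideanSpace ℝ (Fin n))) :=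
    isUnit_iff_ne_zero.2 hdet
  obtain ⟨v, hv⟩ := (LinearMap.equivOfIsUnitDet hu).surjective (r x)
  have hv' : fderiv ℝ r x v = r x := by simpa using hv
  have h5 := h1 v
  rw [hv', real_inner_self_eq_norm_sq, hn] at h5
  exact absurd h5 (by positivity)

theorem interp (n : ℕ) (τ : ℝ) (hτ : 0 < τ) : ∃ (t c : Fin (n+1) → ℝ),
    (∀ i, 0 < t i ∧ t i < τ) ∧ (∑ i, c i = 1) ∧
    ∀ A : EuclideanSpace ℝ (Fin n) →L[ℝ] EuclideanSpace ℝ (Fin n),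
      (1 + A).det = ∑ i, c i * (1 + t i • A).det := by
  let t : Fin (n+1) → ℝ := fun i => τ * ((i:ℝ)+1) / (n+2)
  have ht : Function.Injective t := by
    intro i j h
    simp only [t] at h
    field_simp at h
    have : (i:ℝ) = j := by linarith
    exact Fin.ext (by exact_mod_cast this)
  refine ⟨t, fun i => (Lagrange.basis Finset.univ t i).eval 1, ?_, ?_, ?_⟩
  · intro i
    refine ⟨by positivity, ?_⟩
    simp only [t]
    rw [div_lt_iff₀ (by positivity)]
    have : (i:ℝ) + 1 ≤ n + 1 := by
      have := i.is_lt
      exact_mod_cast this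
    nlinarith
  · rw [← Polynomial.eval_finsetSum, Lagrange.sum_basis ht.injOn (by simp)]; simp
  · intro A
    let b := (EuclideanSpace.basisFun (Fin n) ℝ).toBasis
    let M := LinearMap.toMatrix b b (A : EuclideanSpace ℝ (Fin n) →ₗ[ℝ] EuclideanSpace ℝ (Fin n))
    let p : Polynomial ℝ := Matrix.det ((Polynomial.X : Polynomial ℝ) • M.map Polynomial.C + (1 : Matrix (Fin n) (Fin n) ℝ).map Polynomial.C)
    have hp : ∀ s : ℝ, p.eval s = (1 + s • A).det := by
      intro s
      have : (1 + s • A).det = Matrix.det (1 + s • M) := by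
        rw [ContinuousLinearMap.det, ← LinearMap.det_toMatrix b]
        congr 1
        simp [M]
      rw [this]
      simp only [p]
      rw [← Polynomial.coe_evalRingHom, RingHom.map_det]
      congr 1
      ext i j
      by_cases hij : i = j
      · subst hij; simp [Matrix.map_apply]; ring
      · simp [Matrix.map_apply, Matrix.one_apply_ne hij]; ring
    have hdeg : p.degree < (Finset.univ : Finset (Fin (n+1))).card := by
      refine lt_of_le_of_lt Polynomial.degree_le_natDegree ?_
      have := Polynomial.natDegree_det_X_add_C_le M 1
      simp only [Fintype.card_fin] at this
      simp only [Finset.card_univ, Fintype.card_fin]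
      exact_mod_cast Nat.lt_succ_of_le this
    have := congrArg (Polynomial.eval 1) (Lagrange.eq_interpolate (v := t) ht.injOn hdeg)
    rw [Lagrange.interpolate_apply, Polynomial.eval_finsetSum, hp] at this
    simpa [hp, mul_comm] using this

theorem det_pos_nhds (n : ℕ) : ∃ δ > 0, ∀ A : EuclideanSpace ℝ (Fin n) →L[ℝ] EuclideanSpace ℝ (Fin n),
    ‖A‖ < δ → 0 < (1 + A).det := by
  have hc : Continuous (fun A : EuclideanSpace ℝ (Fin n) →L[ℝ] EuclideanSpace ℝ (Fin n) => (1 + A).det) :=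
    ContinuousLinearMap.continuous_det.comp (by fun_prop)
  have h0 : ∀ᶠ A in 𝓝 (0 : EuclideanSpace ℝ (Fin n) →L[ℝ] EuclideanSpace ℝ (Fin n)), 0 < (1 + A).det := by
    apply hc.continuousAt.eventually (lt_mem_nhds _)
    simp [ContinuousLinearMap.det]
  obtain ⟨δ, hδ, h⟩ := Metric.eventually_nhds_iff.1 h0
  exact ⟨δ, hδ, fun A hA => h (by simpa using hA)⟩

theorem no_retraction {n : ℕ} {r : EuclideanSpace ℝ (Fin n) → EuclideanSpace ℝ (Fin n)} {R : ℝ}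
    (hR : 0 < R) (hd : ContDiff ℝ 1 r) (hn : ∀ x, ‖r x‖ = R) (hid : ∀ x, ‖x‖ = R → r x = x) :
    False := by
  let E := EuclideanSpace ℝ (Fin n)
  have hdiff : Differentiable ℝ r := hd.differentiable (by norm_num)
  let A : E → (E →L[ℝ] E) := fun x => fderiv ℝ r x - 1
  have hA : Continuous A := (hd.continuous_fderiv (by norm_num)).sub continuous_const
  have hderiv : ∀ x, HasFDerivAt (fun x => r x - x) (A x) x := fun x =>
    (hdiff x).hasFDerivAt.sub (hasFDerivAt_id x)
  obtain ⟨L, hL⟩ := (isCompact_closedBall (0:E) R).exists_bound_of_continuousOn hA.continuousOn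
  have hL0 : 0 ≤ L := (norm_nonneg _).trans (hL 0 (by simp [hR.le]))
  have hlip : ∀ x ∈ closedBall (0:E) R, ∀ y ∈ closedBall (0:E) R,
      ‖(r y - y) - (r x - x)‖ ≤ L * ‖y - x‖ := fun x hx y hy =>
    (convex_closedBall (0:E) R).norm_image_sub_le_of_norm_hasFDerivWithin_le
      (f := fun x => r x - x) (fun z _ => (hderiv z).hasFDerivWithinAt) hL hx hy
  let g : E → E := fun x => if ‖x‖ < R then r x - x else 0
  have hgin : ∀ x, ‖x‖ ≤ R → g x = r x - x := by
    intro x hx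
    rcases hx.lt_or_eq with h | h
    · simp [g, h]
    · simp [g, h, hid x h]
  have hgout : ∀ x, R ≤ ‖x‖ → g x = 0 := by
    intro x hx
    simp [g, not_lt.2 hx]
  have key : ∀ x, ‖x‖ ≤ R → ‖g x‖ ≤ L * (R - ‖x‖) := by
    intro x hx
    obtain ⟨z, hz, hzx⟩ : ∃ z : E, ‖z‖ = R ∧ ‖x - z‖ = R - ‖x‖ := by
      by_cases h0 : x = 0
      · exact ⟨r 0, hn 0, by simp [h0, hn]⟩
      · have hx0 : 0 < ‖x‖ := norm_pos_iff.2 h0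
        refine ⟨(R / ‖x‖) • x, ?_, ?_⟩
        · rw [norm_smul, Real.norm_of_nonneg (by positivity)]; field_simp
        · have : x - (R / ‖x‖) • x = (1 - R / ‖x‖) • x := by module
          rw [this, norm_smul, Real.norm_of_nonpos]
          · field_simp; ring
          · rw [sub_nonpos, le_div_iff₀ hx0]; linarith
    have := hlip z (by simp [hz]) x (by simpa using hx)
    rw [← hgin x hx, hid z hz, hzx] at this
    simpa using this
  have hglip : ∀ x y, ‖g x - g y‖ ≤ L * ‖x - y‖ := by
    have aux : ∀ x y, ‖x‖ ≤ R → R ≤ ‖y‖ → ‖g x - g y‖ ≤ L * ‖x - y‖ := by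
      intro x y hx hy
      rw [hgout y hy, sub_zero]
      refine (key x hx).trans (mul_le_mul_of_nonneg_left ?_ hL0)
      have := norm_sub_norm_le y x
      rw [norm_sub_rev] at this
      linarith
    intro x y
    rcases le_total ‖x‖ R with hx | hx <;> rcases le_total ‖y‖ R with hy | hy
    · rw [hgin x hx, hgin y hy]
      exact hlip y (by simpa using hy) x (by simpa using hx)
    · exact aux x y hx hy
    · rw [norm_sub_rev, norm_sub_rev x]; exact aux y x hy hx
    · rw [hgout x hx, hgout y hy]; simp; positivity
  obtain ⟨δ, hδ, hdet⟩ := det_pos_nhds n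
  let τ := min (1 / (L + 1)) (δ / (L + 1))
  have hτ : 0 < τ := by positivity
  obtain ⟨t, c, ht, hc, hint⟩ := interp n τ hτ
  have hcont : ∀ s : ℝ, Continuous fun x => (1 + s • A x).det := fun s =>
    ContinuousLinearMap.continuous_det.comp (by fun_prop)
  have hintg : ∀ s : ℝ, IntegrableOn (fun x => (1 + s • A x).det) (ball (0:E) R) volume := fun s =>
    ((hcont s).continuousOn.integrableOn_compact (isCompact_closedBall (0:E) R)).mono_set
      ball_subset_closedBall
  have hvol : ∀ s : ℝ, 0 < s → s < τ →
      ∫ x in ball (0:E) R, (1 + s • A x).det = volume.real (ball (0:E) R) := by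
    intro s hs hsτ
    have hs1 : s * L < 1 := by
      have : s < 1 / (L + 1) := hsτ.trans_le (min_le_left _ _)
      rw [lt_div_iff₀ (by positivity)] at this
      nlinarith
    have hs2 : s * L < δ := by
      have : s < δ / (L + 1) := hsτ.trans_le (min_le_right _ _)
      rw [lt_div_iff₀ (by positivity)] at this
      nlinarith
    let H : E → E := fun x => x + s • g x
    have hinj : Function.Injective H := by
      intro x y hxy
      have h1 : x - y = - (s • (g x - g y)) := by
        have : x + s • g x = y + s • g y := hxy
        have h0 : x = y + s • g y - s • g x := eq_sub_of_add_eq this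
        rw [smul_sub]
        nth_rewrite 1 [h0]
        abel
      have h2 : ‖x - y‖ ≤ s * L * ‖x - y‖ := by
        calc ‖x - y‖ = s * ‖g x - g y‖ := by
              conv_lhs => rw [h1]
              rw [norm_neg, norm_smul, Real.norm_of_nonneg hs.le]
          _ ≤ s * (L * ‖x - y‖) := by gcongr; exact hglip x y
          _ = _ := by ring
      have h3 : ‖x - y‖ = 0 := by
        have := norm_nonneg (x - y)
        nlinarith
      exact sub_eq_zero.1 (norm_eq_zero.1 h3)
    have hsurj : Function.Surjective H := by
      intro y
      have hcw : ContractingWith ⟨s * L, by positivity⟩ (fun x => y - s • g x) := by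
        refine ⟨by exact_mod_cast hs1, LipschitzWith.of_dist_le_mul fun a b => ?_⟩
        rw [dist_eq_norm, dist_eq_norm]
        have : y - s • g a - (y - s • g b) = - (s • (g a - g b)) := by module
        rw [this, norm_neg, norm_smul, Real.norm_of_nonneg hs.le]
        calc s * ‖g a - g b‖ ≤ s * (L * ‖a - b‖) := by gcongr; exact hglip a b
          _ = s * L * ‖a - b‖ := by ring
      have hfix := hcw.fixedPoint_isFixedPt
      refine ⟨ContractingWith.fixedPoint _ hcw, ?_⟩
      have h := hfix.eq
      simp only [H]
      nth_rewrite 1 [← h]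
      simp
    have himg : H '' ball (0:E) R = ball (0:E) R := by
      ext y
      constructor
      · rintro ⟨x, hx, rfl⟩
        by_contra hy
        have hy' : R ≤ ‖H x‖ := by simpa using hy
        have h1 : H (H x) = H x := by
          change H x + s • g (H x) = H x
          rw [hgout _ hy']; simp
        have h2 := hinj h1
        rw [h2] at hy'
        have : ‖x‖ < R := by simpa using hx
        linarith
      · intro hy
        obtain ⟨x, rfl⟩ := hsurj y
        refine ⟨x, ?_, rfl⟩
        by_contra hx
        have hx' : R ≤ ‖x‖ := by simpa using hx
        have h1 : H x = x := by
          simp [H, hgout _ hx']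
        rw [h1] at hy
        exact hx hy
    have hHd : ∀ x ∈ ball (0:E) R, HasFDerivWithinAt H (1 + s • A x) (ball (0:E) R) x := by
      intro x hx
      have h1 : HasFDerivAt (fun x => x + s • (r x - x)) (1 + s • A x) x :=
        (hasFDerivAt_id x).add ((hderiv x).const_smul s)
      refine h1.hasFDerivWithinAt.congr (fun y hy => ?_) ?_
      · simp only [H]; rw [hgin y (by simpa using (mem_ball_zero_iff.1 hy).le)]
      · simp only [H]; rw [hgin x (by simpa using (mem_ball_zero_iff.1 hx).le)]
    have hch := integral_image_eq_integral_abs_det_fderiv_smul (volume : Measure E)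
      measurableSet_ball hHd hinj.injOn (fun _ => (1:ℝ))
    rw [himg] at hch
    have hpos : ∀ x ∈ ball (0:E) R, |(1 + s • A x).det| • (1:ℝ) = (1 + s • A x).det := by
      intro x hx
      rw [smul_eq_mul, mul_one, abs_of_pos]
      apply hdet
      rw [norm_smul, Real.norm_of_nonneg hs.le]
      refine lt_of_le_of_lt ?_ hs2
      gcongr
      exact hL x (ball_subset_closedBall hx)
    rw [setIntegral_congr_fun measurableSet_ball hpos] at hch
    rw [← hch]; simp
  have hzero : ∀ x, (1 + A x).det = 0 := by
    intro x
    simpa [A] using det_zero hR hdiff hn x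
  have h1 : ∫ x in ball (0:E) R, (1 + A x).det = volume.real (ball (0:E) R) := by
    rw [setIntegral_congr_fun measurableSet_ball (fun x _ => hint (A x))]
    rw [integral_finsetSum _ (fun i _ => (hintg (t i)).const_mul (c i))]
    simp_rw [integral_const_mul]
    rw [Finset.sum_congr rfl (fun i _ => by rw [hvol (t i) (ht i).1 (ht i).2]), ← Finset.sum_mul, hc,
      one_mul]
  simp_rw [hzero] at h1
  have h2 : 0 < volume.real (ball (0:E) R) :=
    ENNReal.toReal_pos (measure_ball_pos _ _ hR).ne' measure_ball_lt_top.ne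
  simp at h1
  linarith

theorem exists_zero {n : ℕ} {H : EuclideanSpace ℝ (Fin n) → EuclideanSpace ℝ (Fin n)} {R : ℝ}
    (hR : 0 < R) (hc : Continuous H) (hid : ∀ x, R ≤ ‖x‖ → H x = x) : ∃ x, H x = 0 := by
  by_contra! hne
  obtain ⟨w, hw, hwd, hws⟩ := (hc.sub continuous_id).exists_contDiff_approx 1
    (ε := fun x => ‖H x‖) hc.norm (fun x => norm_pos_iff.2 (hne x))
  have hw0 : ∀ x, R ≤ ‖x‖ → w x = 0 := by
    intro x hx
    by_contra h
    exact hws h (by simp [hid x hx])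
  have hK : ∀ x, x + w x ≠ 0 := by
    intro x h
    have h1 := hwd x
    have h2 : w x = -x := by rw [eq_neg_iff_add_eq_zero, add_comm]; exact h
    rw [h2, dist_eq_norm] at h1
    have h3 : -x - (H x - x) = -(H x) := by abel
    change ‖-x - (H x - x)‖ < _ at h1
    rw [h3, norm_neg] at h1
    exact lt_irrefl _ h1
  have hKd : ContDiff ℝ 1 (fun x => x + w x) := contDiff_id.add (by exact_mod_cast hw)
  refine no_retraction (r := fun x => (R / ‖x + w x‖) • (x + w x)) hR ?_ ?_ ?_
  · exact (contDiff_const.div (hKd.norm ℝ hK) (fun x => norm_ne_zero_iff.2 (hK x))).smul hKd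
  · intro x
    have := norm_pos_iff.2 (hK x)
    rw [norm_smul, Real.norm_of_nonneg (by positivity)]
    field_simp
  · intro x hx
    simp only [hw0 x hx.ge, add_zero, hx]
    rw [div_self hR.ne', one_smul]

theorem exists_zero_ball {n : ℕ} {h : EuclideanSpace ℝ (Fin n) → EuclideanSpace ℝ (Fin n)}
    (hc : ContinuousOn h (closedBall 0 1)) (hb : ∀ x ∈ closedBall 0 1, ‖h x - x‖ ≤ 1) :
    ∃ x ∈ closedBall 0 1, h x = 0 := by
  let p : EuclideanSpace ℝ (Fin n) → EuclideanSpace ℝ (Fin n) := fun x => (max 1 ‖x‖)⁻¹ • x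
  have hpos : ∀ x : EuclideanSpace ℝ (Fin n), 0 < max 1 ‖x‖ := fun x => by positivity
  have hpm : ∀ x, p x ∈ closedBall (0 : EuclideanSpace ℝ (Fin n)) 1 := by
    intro x
    simp only [p, mem_closedBall_zero_iff, norm_smul, norm_inv, Real.norm_of_nonneg (hpos x).le]
    rw [inv_mul_le_iff₀ (hpos x), mul_one]
    exact le_max_right _ _
  have hpc : Continuous p :=
    ((continuous_const.max continuous_norm).inv₀ (fun x => (hpos x).ne')).smul continuous_id
  have huc : Continuous (fun x => h (p x) - p x) :=
    (hc.comp_continuous hpc hpm).sub hpc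
  let H : EuclideanSpace ℝ (Fin n) → EuclideanSpace ℝ (Fin n) :=
    fun x => x + (max 0 (min 1 (2 - ‖x‖))) • (h (p x) - p x)
  have hH : Continuous H := by
    have hm : Continuous (fun x : EuclideanSpace ℝ (Fin n) => max 0 (min 1 (2 - ‖x‖))) := by fun_prop
    exact continuous_id.add (hm.smul huc)
  obtain ⟨x, hx⟩ := exists_zero (R := 2) (by norm_num) hH (by
    intro x hx
    simp only [H]
    rw [max_eq_left ((min_le_right _ _).trans (by linarith))]; simp)
  rcases le_or_gt ‖x‖ 1 with h1 | h1
  · refine ⟨x, by simpa using h1, ?_⟩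
    have hp : p x = x := by simp [p, max_eq_left h1]
    simp only [H, hp] at hx
    rw [min_eq_left (by linarith), max_eq_right (by norm_num)] at hx
    simpa using hx
  · exfalso
    have hx' : x = -((max 0 (min 1 (2 - ‖x‖))) • (h (p x) - p x)) := eq_neg_of_add_eq_zero_left hx
    have h2 : ‖x‖ ≤ max 0 (min 1 (2 - ‖x‖)) * 1 := by
      conv_lhs => rw [hx']
      rw [norm_neg, norm_smul, Real.norm_of_nonneg (le_max_left _ _)]
      exact mul_le_mul_of_nonneg_left (hb _ (hpm x)) (le_max_left _ _)
    have h3 : max 0 (min 1 (2 - ‖x‖)) ≤ 1 := max_le (by norm_num) (min_le_left _ _)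
    linarith

/-- Invariance of domain, with a left inverse `G` of `f` given. -/
theorem inv_dom {n : ℕ} {f G : EuclideanSpace ℝ (Fin n) → EuclideanSpace ℝ (Fin n)}
    (hf : ContinuousOn f (closedBall 0 1)) (hG : Continuous G)
    (hGf : ∀ x ∈ closedBall 0 1, G (f x) = x) :
    f 0 ∈ interior (f '' closedBall 0 1) := by
  by_contra hnot
  set K := f '' closedBall 0 1 with hKdef
  have hK : IsCompact K := (isCompact_closedBall _ _).image_of_continuousOn hf
  have h0 : (0 : EuclideanSpace ℝ (Fin n)) ∈ closedBall (0 : EuclideanSpace ℝ (Fin n)) 1 := by simp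
  have hG0 : G (f 0) = 0 := hGf 0 h0
  have stab : ∀ F : EuclideanSpace ℝ (Fin n) → EuclideanSpace ℝ (Fin n), ContinuousOn F K →
      (∀ y ∈ K, ‖F y - G y‖ ≤ 1) → ∃ y ∈ K, F y = 0 := by
    intro F hF hFG
    obtain ⟨x, hx, hx0⟩ := exists_zero_ball (h := fun x => F (f x))
      (hF.comp hf (mapsTo_image _ _)) (by
        intro x hx
        have := hFG (f x) (mem_image_of_mem f hx)
        rwa [hGf x hx] at this)
    exact ⟨f x, mem_image_of_mem f hx, hx0⟩
  obtain ⟨e, he, heG⟩ := Metric.continuousAt_iff.1 (hG.continuousAt (x := f 0)) (1/10) (by norm_num)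
  have hGs : ∀ y, dist y (f 0) < e → ‖G y‖ < 1/10 := by
    intro y hy
    have := heG hy
    rwa [hG0, dist_zero_right] at this
  obtain ⟨ε, hε, hεe⟩ : ∃ ε > 0, 2 * ε < e := ⟨e / 3, by positivity, by linarith⟩
  obtain ⟨c, hcK, hcd⟩ : ∃ c, c ∉ K ∧ dist c (f 0) < ε := by
    by_contra! hcon
    apply hnot
    rw [mem_interior_iff_mem_nhds, Metric.mem_nhds_iff]
    refine ⟨ε, hε, fun y hy => ?_⟩
    by_contra hyK
    exact absurd (hcon y hyK) (not_le.2 hy)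
  have hGc : ∀ y, dist y c ≤ ε → ‖G y‖ < 1/10 := by
    intro y hy
    apply hGs
    have := dist_triangle y c (f 0)
    linarith
  let S1 := K ∩ {y | ε ≤ dist y c}
  have hS1 : IsCompact S1 := hK.inter_right (isClosed_le continuous_const (by fun_prop))
  have hS1ne : ∀ y ∈ S1, G y ≠ 0 := by
    rintro y ⟨⟨x, hx, rfl⟩, hy⟩ hzero
    rw [hGf x hx] at hzero
    subst hzero
    have : ε ≤ dist (f 0) c := hy
    rw [dist_comm] at this
    linarith
  obtain ⟨δ, hδ, hδ1, hδG⟩ : ∃ δ > 0, δ ≤ 1/10 ∧ ∀ y ∈ S1, δ ≤ ‖G y‖ := by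
    rcases S1.eq_empty_or_nonempty with h | h
    · exact ⟨1/10, by norm_num, le_rfl, by simp [h]⟩
    · obtain ⟨y, hy, hmin⟩ := hS1.exists_isMinOn h hG.norm.continuousOn
      refine ⟨min (1/10) ‖G y‖, lt_min (by norm_num) (norm_pos_iff.2 (hS1ne y hy)), min_le_left _ _,
        fun z hz => (min_le_right _ _).trans (hmin hz)⟩
  obtain ⟨P, hP, hPG, -⟩ := hG.exists_contDiff_approx 1 (ε := fun _ => δ / 2) continuous_const
    (fun _ => by positivity)
  have hnull : volume (P '' sphere c ε) = 0 :=
    addHaar_image_eq_zero_of_differentiableOn_of_addHaar_eq_zero _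
      (hP.differentiable (by norm_num)).differentiableOn
      (Measure.addHaar_sphere_of_ne_zero _ _ hε.ne')
  obtain ⟨v, hv, hvP⟩ : ∃ v ∈ ball (0 : EuclideanSpace ℝ (Fin n)) (δ / 2), v ∉ P '' sphere c ε := by
    by_contra! hcon
    have h1 := measure_mono (μ := volume) (show ball (0 : EuclideanSpace ℝ (Fin n)) (δ / 2) ⊆ _ from hcon)
    rw [hnull] at h1
    exact absurd h1 (not_le.2 (measure_ball_pos _ _ (by positivity)))
  have hv' : ‖v‖ < δ / 2 := by simpa using hv
  have hPG' : ∀ y, ‖P y - G y‖ < δ / 2 := fun y => by rw [← dist_eq_norm]; exact hPG y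
  let Φ : EuclideanSpace ℝ (Fin n) → EuclideanSpace ℝ (Fin n) :=
    fun y => c + (max (ε / dist y c) 1) • (y - c)
  have hyc : ∀ y ∈ K, 0 < dist y c := fun y hy => dist_pos.2 (fun h => hcK (h ▸ hy))
  have hΦc : ContinuousOn Φ K := by
    have h1 : ContinuousOn (fun y => ε / dist y c) K :=
      continuousOn_const.div (by fun_prop) (fun y hy => (hyc y hy).ne')
    have h2 : ContinuousOn (fun y => max (ε / dist y c) 1) K := h1.sup continuousOn_const
    have h3 : ContinuousOn (fun y => y - c) K := by fun_prop
    exact continuousOn_const.add (h2.smul h3)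
  have hΦ1 : ∀ y ∈ K, ε ≤ dist y c → Φ y = y := by
    intro y hy h
    simp only [Φ]
    rw [max_eq_right ((div_le_one (hyc y hy)).2 h)]; simp
  have hΦ2 : ∀ y ∈ K, dist y c ≤ ε → dist (Φ y) c = ε := by
    intro y hy h
    simp only [Φ]
    rw [max_eq_left ((one_le_div (hyc y hy)).2 h), dist_eq_norm, add_sub_cancel_left, norm_smul,
      ← dist_eq_norm, Real.norm_of_nonneg (by positivity), div_mul_cancel₀ _ (hyc y hy).ne']
  obtain ⟨y, hy, hy0⟩ := stab (fun y => P (Φ y) - v)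
    ((hP.continuous.comp_continuousOn hΦc).sub continuousOn_const) (by
      intro y hy
      rcases le_total ε (dist y c) with h | h
      · rw [hΦ1 y hy h]
        have h1 : P y - v - G y = (P y - G y) - v := by abel
        rw [h1]
        have := norm_sub_le (P y - G y) v
        have := hPG' y
        linarith
      · have h1 : P (Φ y) - v - G y = (P (Φ y) - G (Φ y)) - v + (G (Φ y) - G y) := by abel
        rw [h1]
        have h2 := norm_add_le ((P (Φ y) - G (Φ y)) - v) (G (Φ y) - G y)
        have h3 := norm_sub_le (P (Φ y) - G (Φ y)) v
        have h4 := norm_sub_le (G (Φ y)) (G y)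
        have h5 := hGc y h
        have h6 := hGc (Φ y) (hΦ2 y hy h).le
        have h7 := hPG' (Φ y)
        linarith)
  have hy0' : P (Φ y) = v := sub_eq_zero.1 hy0
  rcases le_total ε (dist y c) with h | h
  · rw [hΦ1 y hy h] at hy0'
    have h1 := hδG y ⟨hy, h⟩
    have h2 := hPG' y
    rw [hy0', norm_sub_rev] at h2
    have h3 := norm_sub_norm_le (G y) v
    linarith
  · exact hvP ⟨Φ y, hΦ2 y hy h, hy0'⟩

end InvDom

open Set Metric in
/-- Trajectories starting on the boundary of the initial set never enter the interior of the
minimal reach set `Ω₂(t;I₀) = ⋂_{d} φ(t; I₀, d)`. -/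
theorem stmt6 {n : ℕ} {P : Type*} (I₀ : Set (EuclideanSpace ℝ (Fin n)))
    (hI : IsCompact I₀)
    (φ : EuclideanSpace ℝ (Fin n) → P → EuclideanSpace ℝ (Fin n))
    -- for each perturbation d, φ(·,d) is a homeomorphism of the compact set I₀ onto its image
    (hcont : ∀ d : P, ContinuousOn (fun x => φ x d) I₀)
    (hinj : ∀ d : P, Set.InjOn (fun x => φ x d) I₀)
    (x₀ : EuclideanSpace ℝ (Fin n)) (hx₀ : x₀ ∈ frontier I₀) (d : P) :
    φ x₀ d ∉ interior (⋂ d' : P, (fun x => φ x d') '' I₀) := by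
  intro hmem
  have hx₀I : x₀ ∈ I₀ := hI.isClosed.frontier_subset hx₀
  set f : EuclideanSpace ℝ (Fin n) → EuclideanSpace ℝ (Fin n) := fun x => φ x d with hf
  have hmem' : f x₀ ∈ interior (f '' I₀) := interior_mono (iInter_subset _ d) hmem
  rw [mem_interior_iff_mem_nhds, Metric.nhds_basis_closedBall.mem_iff] at hmem'
  obtain ⟨ρ, hρ, hball⟩ := hmem'
  obtain ⟨F, hF⟩ := ContinuousMap.exists_restrict_eq hI.isClosed
    (⟨I₀.domRestrict f, (hcont d).domRestrict⟩ : C(I₀, EuclideanSpace ℝ (Fin n)))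
  have hFf : ∀ x ∈ I₀, F x = f x := fun x hx => congrArg (fun g => g ⟨x, hx⟩) hF
  have hginv : ∀ y ∈ f '' I₀, Function.invFunOn f I₀ y ∈ I₀ ∧ f (Function.invFunOn f I₀ y) = y :=
    fun y hy => ⟨Function.invFunOn_mem hy, Function.invFunOn_eq hy⟩
  have hgc : ContinuousOn (Function.invFunOn f I₀) (f '' I₀) := by
    rw [continuousOn_iff_isClosed]
    intro t ht
    refine ⟨f '' (I₀ ∩ t), ((hI.inter_right ht).image_of_continuousOn
      ((hcont d).mono inter_subset_left)).isClosed, ?_⟩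
    ext y
    constructor
    · rintro ⟨hy, hyI⟩
      exact ⟨⟨_, ⟨(hginv y hyI).1, hy⟩, (hginv y hyI).2⟩, hyI⟩
    · rintro ⟨⟨x, ⟨hx, hxt⟩, rfl⟩, hyI⟩
      refine ⟨?_, hyI⟩
      have : Function.invFunOn f I₀ (f x) = x :=
        hinj d (hginv _ hyI).1 hx (hginv _ hyI).2
      rw [mem_preimage, this]; exact hxt
  have hmaps : MapsTo (fun u => f x₀ + ρ • u) (closedBall 0 1) (f '' I₀) := by
    intro u hu
    apply hball
    have hu' : ‖u‖ ≤ 1 := by simpa using hu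
    rw [mem_closedBall, dist_eq_norm, add_sub_cancel_left, norm_smul, Real.norm_of_nonneg hρ.le]
    nlinarith
  have key := InvDom.inv_dom (f := fun u => Function.invFunOn f I₀ (f x₀ + ρ • u))
    (G := fun x => ρ⁻¹ • (F x - f x₀)) (hgc.comp (by fun_prop) hmaps) (by fun_prop) (by
      intro u hu
      have h1 := hginv _ (hmaps hu)
      rw [hFf _ h1.1, h1.2, add_sub_cancel_left, smul_smul, inv_mul_cancel₀ hρ.ne', one_smul])
  have hg0 : Function.invFunOn f I₀ (f x₀ + ρ • 0) = x₀ := by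
    rw [smul_zero, add_zero]
    have h1 := hginv (f x₀) (mem_image_of_mem f hx₀I)
    exact hinj d h1.1 hx₀I h1.2
  simp only [hg0] at key
  have hsub : (fun u => Function.invFunOn f I₀ (f x₀ + ρ • u)) '' closedBall 0 1 ⊆ I₀ := by
    rintro _ ⟨u, hu, rfl⟩
    exact (hginv _ (hmaps hu)).1
  exact hx₀.2 (interior_mono hsub key)
end

section
/- Let I₀ ⊆ ℝ^n be compact and suppose for each d ∈ D̂ the map φ(t; ·, d) : I₀ → Ω(t; I₀, d) is a homeomorphism onto the compact set Ω(t; I₀, d), with Ω₁(t; I₀) = ⋃_{d∈D̂} Ω(t; I₀, d) compact. Then every x ∈ ∂Ω₁(t; I₀) is of the form x = φ(t; x₀, d) with x₀ ∈ ∂I₀ and d ∈ D̂; that is, ∂Ω₁(t; I₀) ⊆ Ω₁(t; ∂I₀). -/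
open Set Metric MeasureTheory

theorem iod_det_poly (n : ℕ) (t0 : ℝ) (ht0 : 0 < t0) :
    ∃ (s : Finset ℝ) (c : ℝ → ℝ), (∀ t ∈ s, 0 < t ∧ t < t0) ∧
      ∀ A : EuclideanSpace ℝ (Fin n) →L[ℝ] EuclideanSpace ℝ (Fin n),
        (1 + A).det = ∑ t ∈ s, c t * (1 + t • A).det := by
  classical
  obtain ⟨s, hs, hcard⟩ := (Set.Ioo_infinite ht0).exists_subset_card_eq (n + 1)
  refine ⟨s, fun t => (Lagrange.basis s id t).eval 1, fun t ht => hs ht, fun A => ?_⟩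
  let b := (EuclideanSpace.basisFun (Fin n) ℝ).toBasis
  let M := LinearMap.toMatrix b b (A : EuclideanSpace ℝ (Fin n) →ₗ[ℝ] EuclideanSpace ℝ (Fin n))
  let p : Polynomial ℝ := Matrix.det ((Polynomial.X : Polynomial ℝ) • M.map Polynomial.C
    + (1 : Matrix (Fin n) (Fin n) ℝ).map Polynomial.C)
  have hdeg : p.degree < s.card := by
    refine lt_of_le_of_lt Polynomial.degree_le_natDegree ?_
    have := Polynomial.natDegree_det_X_add_C_le M 1
    rw [Fintype.card_fin] at this
    rw [hcard]
    exact_mod_cast Nat.lt_succ_of_le this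
  have hev : ∀ t : ℝ, p.eval t = (1 + t • A).det := by
    intro t
    have h1 : (1 + t • A).det = LinearMap.det ((1 + t • A : EuclideanSpace ℝ (Fin n) →L[ℝ] EuclideanSpace ℝ (Fin n)) : EuclideanSpace ℝ (Fin n) →ₗ[ℝ] EuclideanSpace ℝ (Fin n)) := rfl
    rw [h1, ← LinearMap.det_toMatrix b, ← Polynomial.coe_evalRingHom, RingHom.map_det]
    congr 1
    have h2 : ((1 + t • A : EuclideanSpace ℝ (Fin n) →L[ℝ] EuclideanSpace ℝ (Fin n)) : EuclideanSpace ℝ (Fin n) →ₗ[ℝ] EuclideanSpace ℝ (Fin n)) = 1 + t • (A : EuclideanSpace ℝ (Fin n) →ₗ[ℝ] EuclideanSpace ℝ (Fin n)) := rfl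
    rw [h2, map_add (LinearMap.toMatrix b b), map_smul (LinearMap.toMatrix b b), LinearMap.toMatrix_one]
    ext i j
    simp [M, Matrix.one_apply, add_comm]
    split_ifs <;> simp [mul_comm]
  have := Lagrange.eq_interpolate (s := s) (v := id) (f := p) (Function.injective_id.injOn) hdeg
  have h3 := congrArg (Polynomial.eval 1) this
  rw [hev, one_smul, Lagrange.interpolate_apply, Polynomial.eval_finsetSum] at h3
  rw [h3]
  refine Finset.sum_congr rfl fun t _ => ?_
  rw [Polynomial.eval_mul, Polynomial.eval_C, id, hev, mul_comm]

/-- the determinant is positive near the identity -/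
theorem iod_det_pos {n : ℕ} (A : EuclideanSpace ℝ (Fin n) →L[ℝ] EuclideanSpace ℝ (Fin n))
    (hA : ‖A‖ < 1) : 0 < (1 + A).det := by
  have hne : ∀ s ∈ Icc (0:ℝ) 1, (1 + s • A).det ≠ 0 := by
    intro s hs h0
    have hn : ‖-(s • A)‖ < 1 := by
      rw [norm_neg, norm_smul, Real.norm_of_nonneg hs.1]
      nlinarith [norm_nonneg A, hs.2]
    have hu : IsUnit (1 - (-(s • A))) := isUnit_one_sub_of_norm_lt_one hn
    rw [sub_neg_eq_add] at hu
    obtain ⟨B, hB⟩ := hu.exists_right_inv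
    have h1 : (1 + s • A).det * B.det = 1 := by
      have h2 : ((1 + s • A) * B).det = (1 + s • A).det * B.det :=
        map_mul LinearMap.det _ _
      rw [← h2, hB]
      simp [ContinuousLinearMap.det]
    rw [h0, zero_mul] at h1
    exact zero_ne_one h1
  have hc : Continuous fun s : ℝ => (1 + s • A).det :=
    ContinuousLinearMap.continuous_det.comp (by fun_prop)
  by_contra hneg
  push Not at hneg
  have := intermediate_value_Icc' (zero_le_one) hc.continuousOn (a := (0:ℝ)) (b := 1)
  obtain ⟨s, hs, h⟩ := this (show (0:ℝ) ∈ Icc _ _ by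
    refine ⟨by simpa using hneg, ?_⟩
    simp [ContinuousLinearMap.det])
  exact hne s hs h

theorem iod_lip {n : ℕ} (g : EuclideanSpace ℝ (Fin n) → EuclideanSpace ℝ (Fin n)) (K : NNReal)
    (hg : LipschitzOnWith K g (closedBall 0 1)) (h0 : ∀ x, ‖x‖ = 1 → g x = 0) :
    LipschitzWith K ((closedBall 0 1).indicator g) := by
  have key : ∀ x y : EuclideanSpace ℝ (Fin n), ‖x‖ ≤ 1 → ¬ ‖y‖ ≤ 1 → dist (g x) 0 ≤ K * dist x y := by
    intro x y hx hy
    push Not at hy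
    have hc : Continuous fun s : ℝ => ‖AffineMap.lineMap x y s‖ := by
      have : Continuous (AffineMap.lineMap x y : ℝ → EuclideanSpace ℝ (Fin n)) := AffineMap.lineMap_continuous
      fun_prop
    obtain ⟨s, hs, h⟩ := intermediate_value_Icc (zero_le_one) hc.continuousOn (a := (0:ℝ)) (b := 1)
      (show (1:ℝ) ∈ Icc _ _ by simp [hx, hy.le])
    simp only at h
    rw [← h0 _ h]
    refine (hg.dist_le_mul _ (by simpa using hx) _ (by simp [h])).trans ?_
    gcongr
    rw [dist_comm, dist_lineMap_left, Real.norm_of_nonneg hs.1]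
    nlinarith [dist_nonneg (x := x) (y := y), hs.2]
  refine LipschitzWith.of_dist_le_mul fun x y => ?_
  by_cases hx : ‖x‖ ≤ 1 <;> by_cases hy : ‖y‖ ≤ 1
  · rw [indicator_of_mem (by simpa using hx), indicator_of_mem (by simpa using hy)]
    exact hg.dist_le_mul _ (by simpa using hx) _ (by simpa using hy)
  · rw [indicator_of_mem (by simpa using hx), indicator_of_notMem (by simpa using hy)]
    exact key x y hx hy
  · rw [indicator_of_notMem (by simpa using hx), indicator_of_mem (by simpa using hy), dist_comm, dist_comm x]
    exact key y x hy hx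
  · rw [indicator_of_notMem (by simpa using hx), indicator_of_notMem (by simpa using hy), dist_self]
    positivity

theorem iod_bij {n : ℕ} (g : EuclideanSpace ℝ (Fin n) → EuclideanSpace ℝ (Fin n)) (K : NNReal)
    (hK : K < 1) (hg : LipschitzWith K g) : Function.Bijective (fun x => x + g x) := by
  constructor
  · intro x y hxy
    have h1 : x - y = g y - g x := by
      simp only at hxy
      rw [sub_eq_sub_iff_add_eq_add, hxy, add_comm]
    have h2 := hg.dist_le_mul y x
    rw [dist_eq_norm, ← h1, dist_comm, dist_eq_norm] at h2
    have hK' : (K : ℝ) < 1 := by exact_mod_cast hK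
    have : ‖x - y‖ = 0 := by nlinarith [norm_nonneg (x - y)]
    exact sub_eq_zero.1 (norm_eq_zero.1 this)
  · intro y
    have hc : ContractingWith K (fun x => y - g x) := by
      refine ⟨hK, LipschitzWith.of_dist_le_mul fun a b => ?_⟩
      rw [dist_sub_left]
      exact hg.dist_le_mul a b
    refine ⟨hc.fixedPoint, ?_⟩
    have := hc.fixedPoint_isFixedPt
    have h2 : y - g hc.fixedPoint = hc.fixedPoint := this
    simp only
    nth_rewrite 1 [← h2]
    simp

theorem iod_vol {n : ℕ} (g : EuclideanSpace ℝ (Fin n) → EuclideanSpace ℝ (Fin n)) (K : NNReal)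
    (hg : LipschitzOnWith K g (closedBall 0 1)) (h0 : ∀ x, ‖x‖ = 1 → g x = 0)
    (hd : ∀ x ∈ ball (0 : EuclideanSpace ℝ (Fin n)) 1, DifferentiableAt ℝ g x)
    (t : ℝ) (ht : 0 < t) (htK : t * K < 1) :
    ∫ x in ball (0 : EuclideanSpace ℝ (Fin n)) 1, (1 + t • fderiv ℝ g x).det =
      volume.real (ball (0 : EuclideanSpace ℝ (Fin n)) 1) := by
  set g' := (closedBall 0 1).indicator g with hg'
  have hlip := iod_lip g K hg h0
  have hlip' : LipschitzWith (t.toNNReal * K) (fun x => t • g' x) := by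
    refine LipschitzWith.of_dist_le_mul fun a b => ?_
    rw [dist_smul₀, Real.norm_of_nonneg ht.le, NNReal.coe_mul, Real.coe_toNNReal _ ht.le, mul_assoc]
    gcongr
    exact hlip.dist_le_mul a b
  have hbij := iod_bij _ _ (by
    rw [← NNReal.coe_lt_coe]
    simpa [Real.coe_toNNReal _ ht.le] using htK) hlip'
  set f := fun x => x + t • g' x with hf
  have hout : ∀ x, x ∉ ball (0 : EuclideanSpace ℝ (Fin n)) 1 → f x = x := by
    intro x hx
    have : g' x = 0 := by
      by_cases h1 : x ∈ closedBall (0 : EuclideanSpace ℝ (Fin n)) 1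
      · rw [hg', indicator_of_mem h1]
        apply h0
        simp at hx h1
        linarith
      · rw [hg', indicator_of_notMem h1]
    simp [hf, this]
  have himg : f '' ball 0 1 = ball 0 1 := by
    apply Subset.antisymm
    · rintro _ ⟨x, hx, rfl⟩
      by_contra hn
      have := hbij.1 (hout _ hn)
      rw [this] at hn
      exact hn hx
    · intro y hy
      obtain ⟨x, rfl⟩ := hbij.2 y
      refine ⟨x, ?_, rfl⟩
      by_contra hn
      rw [hout x hn] at hy
      exact hn hy
  have hder : ∀ x ∈ ball (0 : EuclideanSpace ℝ (Fin n)) 1,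
      HasFDerivWithinAt f (1 + t • fderiv ℝ g x) (ball 0 1) x := by
    intro x hx
    have h1 : HasFDerivAt (fun x => x + t • g x) (1 + t • fderiv ℝ g x) x :=
      (hasFDerivAt_id x).add ((hd x hx).hasFDerivAt.const_smul t)
    have h2 : ∀ y ∈ ball (0 : EuclideanSpace ℝ (Fin n)) 1, f y = y + t • g y := by
      intro y hy
      simp only [hf, hg']
      rw [indicator_of_mem (ball_subset_closedBall hy)]
    exact h1.hasFDerivWithinAt.congr h2 (h2 x hx)
  have hcv := integral_image_eq_integral_abs_det_fderiv_smul volume measurableSet_ball hder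
    hbij.1.injOn (fun _ => (1:ℝ))
  rw [himg] at hcv
  simp only [smul_eq_mul, mul_one, integral_const, measureReal_restrict_apply_univ] at hcv
  rw [hcv]
  refine setIntegral_congr_fun measurableSet_ball fun x hx => ?_
  rw [abs_of_pos]
  apply iod_det_pos
  have : ‖fderiv ℝ g x‖ ≤ K := norm_fderiv_le_of_lipschitzOn ℝ
    (Filter.mem_of_superset (isOpen_ball.mem_nhds hx) ball_subset_closedBall) hg
  rw [norm_smul, Real.norm_of_nonneg ht.le]
  nlinarith

theorem iod_no_retract {n : ℕ} (U : Set (EuclideanSpace ℝ (Fin n))) (hU : IsOpen U)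
    (hBU : closedBall 0 1 ⊆ U) (r : EuclideanSpace ℝ (Fin n) → EuclideanSpace ℝ (Fin n))
    (hr : ContDiffOn ℝ 1 r U) (hr1 : ∀ x ∈ closedBall (0 : EuclideanSpace ℝ (Fin n)) 1, ‖r x‖ = 1)
    (hr2 : ∀ x, ‖x‖ = 1 → r x = x) : False := by
  set g := fun x => r x - x with hg
  have hgU : ContDiffOn ℝ 1 g U := hr.sub contDiffOn_id
  obtain ⟨K, hK⟩ := LocallyLipschitzOn.exists_lipschitzOnWith_of_compact
    (isCompact_closedBall (0 : EuclideanSpace ℝ (Fin n)) 1)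
    ((hgU.mono hBU).locallyLipschitzOn (convex_closedBall _ _))
  have hg0 : ∀ x, ‖x‖ = 1 → g x = 0 := fun x hx => by simp [hg, hr2 x hx]
  have hrd : ∀ x ∈ ball (0 : EuclideanSpace ℝ (Fin n)) 1, DifferentiableAt ℝ r x := fun x hx =>
    (hr.differentiableOn one_ne_zero).differentiableAt (hU.mem_nhds (hBU (ball_subset_closedBall hx)))
  have hgd : ∀ x ∈ ball (0 : EuclideanSpace ℝ (Fin n)) 1, DifferentiableAt ℝ g x := fun x hx =>
    (hrd x hx).sub differentiableAt_id
  have hKp : (0:ℝ) < 1 / (K + 1) := by positivity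
  obtain ⟨s, c, hs, hdet⟩ := iod_det_poly n _ hKp
  have hvol : ∀ t ∈ s, ∫ x in ball (0 : EuclideanSpace ℝ (Fin n)) 1, (1 + t • fderiv ℝ g x).det =
      volume.real (ball (0 : EuclideanSpace ℝ (Fin n)) 1) := by
    intro t ht
    refine iod_vol g K hK hg0 hgd t (hs t ht).1 ?_
    have h1 := (hs t ht).2
    rw [lt_div_iff₀ (by positivity)] at h1
    linarith [(hs t ht).1]
  have hcont : ∀ t : ℝ, IntegrableOn (fun x => (1 + t • fderiv ℝ g x).det)
      (ball (0 : EuclideanSpace ℝ (Fin n)) 1) := by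
    intro t
    have h1 : ContinuousOn (fderiv ℝ g) (closedBall 0 1) :=
      (hgU.continuousOn_fderiv_of_isOpen hU le_rfl).mono hBU
    have h2 : ContinuousOn (fun x => (1 + t • fderiv ℝ g x).det)
      (closedBall (0 : EuclideanSpace ℝ (Fin n)) 1) :=
      ContinuousLinearMap.continuous_det.comp_continuousOn
        (continuousOn_const.add (h1.const_smul t))
    exact (h2.integrableOn_compact (isCompact_closedBall _ _)).mono_set ball_subset_closedBall
  have hsum : ∑ t ∈ s, c t = 1 := by
    have := hdet 0
    simp [ContinuousLinearMap.det] at this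
    exact this.symm
  have hI : ∫ x in ball (0 : EuclideanSpace ℝ (Fin n)) 1, (1 + fderiv ℝ g x).det =
      volume.real (ball (0 : EuclideanSpace ℝ (Fin n)) 1) := by
    rw [setIntegral_congr_fun measurableSet_ball (fun x _ => hdet (fderiv ℝ g x))]
    rw [integral_finsetSum _ (fun t _ => (hcont t).const_mul (c t))]
    simp_rw [integral_const_mul]
    rw [Finset.sum_congr rfl fun t ht => by rw [hvol t ht], ← Finset.sum_mul, hsum, one_mul]
  have hzero : ∀ x ∈ ball (0 : EuclideanSpace ℝ (Fin n)) 1, (1 + fderiv ℝ g x).det = 0 := by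
    intro x hx
    have h1 : 1 + fderiv ℝ g x = fderiv ℝ r x := by
      have : fderiv ℝ g x = fderiv ℝ r x - 1 := by
        exact ((hrd x hx).hasFDerivAt.sub (hasFDerivAt_id x)).fderiv
      rw [this]; abel
    rw [h1]
    by_contra hne
    have hsurj : Function.Surjective (fderiv ℝ r x) := by
      have := (LinearMap.isUnit_iff_isUnit_det (fderiv ℝ r x : EuclideanSpace ℝ (Fin n) →ₗ[ℝ] EuclideanSpace ℝ (Fin n))).2 (isUnit_iff_ne_zero.2 hne)
      exact ((Module.End.isUnit_iff _).1 this).2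
    obtain ⟨v, hv⟩ := hsurj (r x)
    have h2 : HasFDerivAt (fun y => ‖r y‖ ^ 2) (2 • (innerSL ℝ (r x)).comp (fderiv ℝ r x)) x :=
      (hrd x hx).hasFDerivAt.norm_sq
    have h3 : HasFDerivAt (fun y => ‖r y‖ ^ 2) (0 : EuclideanSpace ℝ (Fin n) →L[ℝ] ℝ) x := by
      refine (hasFDerivAt_const (1:ℝ) x).congr_of_eventuallyEq ?_
      filter_upwards [isOpen_ball.mem_nhds hx] with y hy
      rw [hr1 y (ball_subset_closedBall hy)]; norm_num
    have h4 := congrArg (fun L => L v) (h2.unique h3)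
    simp [hv, hr1 x (ball_subset_closedBall hx)] at h4
  rw [setIntegral_congr_fun measurableSet_ball hzero] at hI
  simp at hI
  have : 0 < volume.real (ball (0 : EuclideanSpace ℝ (Fin n)) 1) := by
    rw [measureReal_def]
    exact ENNReal.toReal_pos (measure_ball_pos _ _ one_pos).ne' measure_ball_lt_top.ne
  linarith

theorem iod_brouwer_smooth {n : ℕ} (q : EuclideanSpace ℝ (Fin n) → EuclideanSpace ℝ (Fin n))
    (hq : ContDiff ℝ 1 q) (hq1 : ∀ x ∈ closedBall (0 : EuclideanSpace ℝ (Fin n)) 1, ‖q x‖ < 1)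
    (hq2 : ∀ x ∈ closedBall (0 : EuclideanSpace ℝ (Fin n)) 1, q x ≠ x) : False := by
  set u := fun x => x - q x with hu
  have huc : ContDiff ℝ 1 u := contDiff_id.sub hq
  set a : EuclideanSpace ℝ (Fin n) → ℝ := fun x => ‖u x‖ ^ 2 with ha
  have hac : ContDiff ℝ 1 a := huc.norm_sq ℝ
  set b : EuclideanSpace ℝ (Fin n) → ℝ := fun x => inner ℝ x (u x) with hb
  have hbc : ContDiff ℝ 1 b := contDiff_id.inner ℝ huc
  set D : EuclideanSpace ℝ (Fin n) → ℝ := fun x => b x ^ 2 + a x * (1 - ‖x‖ ^ 2) with hD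
  have hDc : ContDiff ℝ 1 D :=
    (hbc.pow 2).add (hac.mul (contDiff_const.sub (contDiff_id.norm_sq ℝ)))
  have hapos : ∀ x ∈ closedBall (0 : EuclideanSpace ℝ (Fin n)) 1, 0 < a x := by
    intro x hx
    have : 0 < ‖u x‖ := norm_pos_iff.2 (sub_ne_zero.2 (hq2 x hx).symm)
    simp only [ha]; positivity
  have hbpos : ∀ x, ‖x‖ = 1 → 0 < b x := by
    intro x hx
    have h1 := hq1 x (by simp [hx])
    have h2 := real_inner_le_norm x (q x)
    simp only [hb, hu, inner_sub_right, real_inner_self_eq_norm_sq, hx] at *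
    linarith
  have hDpos : ∀ x ∈ closedBall (0 : EuclideanSpace ℝ (Fin n)) 1, 0 < D x := by
    intro x hx
    have hx' : ‖x‖ ≤ 1 := by simpa using hx
    rcases hx'.lt_or_eq with h | h
    · have h1 : 0 < 1 - ‖x‖ ^ 2 := by nlinarith [norm_nonneg x]
      have := mul_pos (hapos x hx) h1
      simp only [hD]; positivity
    · have := hbpos x h
      simp only [hD, h]
      norm_num
      positivity
  set U := {x | a x ≠ 0} ∩ {x | D x ≠ 0} with hU
  have hUo : IsOpen U := (isOpen_ne_fun hac.continuous continuous_const).inter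
    (isOpen_ne_fun hDc.continuous continuous_const)
  refine iod_no_retract U hUo (fun x hx => ⟨(hapos x hx).ne', (hDpos x hx).ne'⟩)
    (fun x => x + ((-b x + Real.sqrt (D x)) / a x) • u x) ?_ ?_ ?_
  · refine contDiffOn_id.add (ContDiffOn.smul (ContDiffOn.div ?_ hac.contDiffOn fun x hx => hx.1)
      huc.contDiffOn)
    exact hbc.contDiffOn.neg.add (hDc.contDiffOn.sqrt fun x hx => hx.2)
  · intro x hx
    have h1 : ‖x + ((-b x + Real.sqrt (D x)) / a x) • u x‖ ^ 2 = 1 := by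
      rw [norm_add_sq_real, inner_smul_right, norm_smul, mul_pow, Real.norm_eq_abs, sq_abs]
      have hs := Real.sq_sqrt (hDpos x hx).le
      have hab : D x = b x ^ 2 + a x * (1 - ‖x‖ ^ 2) := rfl
      have h2 : inner ℝ x (u x) = b x := rfl
      have h3 : ‖u x‖ ^ 2 = a x := rfl
      rw [h2, h3]
      have := (hapos x hx).ne'
      field_simp
      nlinarith
    have h4 := norm_nonneg (x + ((-b x + Real.sqrt (D x)) / a x) • u x)
    nlinarith
  · intro x hx
    have : D x = b x ^ 2 := by simp [hD, hx]
    simp only [this, Real.sqrt_sq (hbpos x hx).le]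
    simp

theorem iod_brouwer {n : ℕ} (f : EuclideanSpace ℝ (Fin n) → EuclideanSpace ℝ (Fin n))
    (hf : ContinuousOn f (closedBall 0 1))
    (hm : ∀ x ∈ closedBall (0 : EuclideanSpace ℝ (Fin n)) 1, ‖f x‖ ≤ 1) :
    ∃ x ∈ closedBall (0 : EuclideanSpace ℝ (Fin n)) 1, f x = x := by
  by_contra hno
  push Not at hno
  have : TietzeExtension (EuclideanSpace ℝ (Fin n)) := TietzeExtension.of_tvs ℝ
  obtain ⟨F, hF⟩ := ContinuousMap.exists_restrict_eq
    (isClosed_closedBall (x := (0 : EuclideanSpace ℝ (Fin n))) (ε := 1))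
    ⟨_, hf.domRestrict⟩
  have hF' : ∀ x ∈ closedBall (0 : EuclideanSpace ℝ (Fin n)) 1, F x = f x := fun x hx =>
    congrArg (fun G => G ⟨x, hx⟩) hF
  obtain ⟨m, hm0, hmle⟩ := (isCompact_closedBall (0 : EuclideanSpace ℝ (Fin n)) 1).exists_forall_le'
    (f := fun x => ‖F x - x‖) (by fun_prop) (a := 0)
    (fun x hx => norm_pos_iff.2 (sub_ne_zero.2 (by rw [hF' x hx]; exact hno x hx)))
  set δ := m / 3 with hδ
  have hδ0 : 0 < δ := by positivity
  obtain ⟨p, hpc, hp, -⟩ := F.continuous.exists_contDiff_approx 1 (ε := fun _ => δ)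
    continuous_const (fun _ => hδ0)
  have hpn : ∀ x ∈ closedBall (0 : EuclideanSpace ℝ (Fin n)) 1, ‖p x‖ < 1 + δ := by
    intro x hx
    have h1 := hp x
    rw [dist_eq_norm] at h1
    have h2 := hm x hx
    rw [← hF' x hx] at h2
    have := norm_add_le (p x - F x) (F x)
    rw [sub_add_cancel] at this
    linarith
  refine iod_brouwer_smooth (fun x => (1 + δ)⁻¹ • p x) (by exact_mod_cast hpc.const_smul (1 + δ)⁻¹) ?_ ?_
  · intro x hx
    rw [norm_smul, norm_inv, Real.norm_of_nonneg (by positivity), inv_mul_lt_iff₀ (by positivity),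
      mul_one]
    exact hpn x hx
  · intro x hx hfix
    have h1 : p x = (1 + δ) • x := by
      nth_rewrite 2 [← hfix]
      rw [smul_inv_smul₀ (by positivity)]
    have hx' : ‖x‖ ≤ 1 := by simpa using hx
    have h2 : ‖p x - x‖ ≤ δ := by
      rw [h1, add_smul, one_smul, add_sub_cancel_left, norm_smul, Real.norm_of_nonneg hδ0.le]
      nlinarith
    have h3 := hp x
    rw [dist_comm, dist_eq_norm] at h3
    have h4 := norm_add_le (F x - p x) (p x - x)
    rw [sub_add_sub_cancel] at h4
    have := hmle x hx
    linarith

theorem iod_main {n : ℕ} (f : EuclideanSpace ℝ (Fin n) → EuclideanSpace ℝ (Fin n))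
    (hf : ContinuousOn f (closedBall 0 1)) (hinj : InjOn f (closedBall 0 1)) :
    f 0 ∈ interior (f '' closedBall 0 1) := by
  by_contra hint
  set B := closedBall (0 : EuclideanSpace ℝ (Fin n)) 1 with hB
  have hBc : IsCompact B := isCompact_closedBall _ _
  have h0B : (0 : EuclideanSpace ℝ (Fin n)) ∈ B := by simp [hB]
  have : TietzeExtension (EuclideanSpace ℝ (Fin n)) := TietzeExtension.of_tvs ℝ
  have : CompactSpace B := isCompact_iff_compactSpace.1 hBc
  have hemb : Topology.IsClosedEmbedding (fun x : B => f x) :=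
    hf.domRestrict.isClosedEmbedding (fun x y h => Subtype.ext (hinj x.2 y.2 h))
  obtain ⟨G, hG⟩ := ContinuousMap.exists_extension' hemb
    (⟨Subtype.val, continuous_subtype_val⟩ : C(B, EuclideanSpace ℝ (Fin n)))
  have hG' : ∀ x ∈ B, G (f x) = x := fun x hx => congrFun hG ⟨x, hx⟩
  have hSc : IsCompact (f '' B) := hBc.image_of_continuousOn hf
  obtain ⟨ε', hε', hsmall⟩ := Metric.continuousAt_iff.1 (G.continuous.continuousAt (x := f 0))
    (1/10) (by norm_num)
  set ε := ε' / 3 with hεd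
  have hε : 0 < ε := by positivity
  obtain ⟨c, hcS, hc⟩ : ∃ c, c ∉ f '' B ∧ dist c (f 0) < ε := by
    by_contra hno
    push Not at hno
    apply hint
    rw [mem_interior_iff_mem_nhds, Metric.mem_nhds_iff]
    refine ⟨ε, hε, fun y hy => ?_⟩
    by_contra hyS
    exact absurd (mem_ball.1 hy) (not_lt.2 (hno y hyS))
  have hsm : ∀ y, dist y c ≤ ε → ‖G y‖ < 1/10 := by
    intro y hy
    have h1 := hsmall (x := y) (by linarith [dist_triangle y c (f 0)])
    rwa [hG' 0 h0B, dist_zero_right] at h1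
  have hSig : IsCompact (f '' B ∩ {y | ε ≤ dist y c}) :=
    hSc.inter_right (isClosed_le continuous_const (by fun_prop))
  obtain ⟨m, hm0, hm⟩ := hSig.exists_forall_le' (f := fun y => ‖G y‖) (by fun_prop) (a := 0) (by
    rintro _ ⟨⟨x, hx, rfl⟩, hy⟩
    rw [norm_pos_iff, hG' x hx]
    rintro rfl
    rw [mem_ofPred_eq, dist_comm] at hy
    linarith)
  set δ := min (m / 2) (1 / 20) with hδ
  have hδ0 : 0 < δ := by positivity
  have hδm : 2 * δ ≤ m := by linarith [min_le_left (m / 2) (1 / 20)]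
  have hδ1 : 2 * δ ≤ 1 / 10 := by linarith [min_le_right (m / 2) (1 / 20)]
  obtain ⟨p, hpc, hp, -⟩ := G.continuous.exists_contDiff_approx 1 (ε := fun _ => δ)
    continuous_const (fun _ => hδ0)
  have hnull : volume (p '' sphere c ε) = 0 :=
    addHaar_image_eq_zero_of_differentiableOn_of_addHaar_eq_zero volume
      (hpc.differentiable one_ne_zero).differentiableOn
      (Measure.addHaar_sphere_of_ne_zero volume c hε.ne')
  obtain ⟨v, hvb, hvn⟩ : ∃ v, v ∈ ball (0 : EuclideanSpace ℝ (Fin n)) δ ∧ v ∉ p '' sphere c ε := by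
    by_contra hno
    push Not at hno
    have := measure_mono_null hno hnull
    exact (measure_ball_pos volume (0 : EuclideanSpace ℝ (Fin n)) hδ0).ne' this
  have hPG : ∀ y, ‖G y - (p y - v)‖ < 2 * δ := by
    intro y
    have h1 := hp y
    rw [dist_comm, dist_eq_norm] at h1
    have h2 : ‖v‖ < δ := by simpa using hvb
    have : G y - (p y - v) = G y - p y + v := by abel
    rw [this]
    exact (norm_add_le _ _).trans_lt (by linarith)
  set Φ : EuclideanSpace ℝ (Fin n) → EuclideanSpace ℝ (Fin n) :=
    fun y => c + max (ε / ‖y - c‖) 1 • (y - c) with hΦ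
  have hne : ∀ y ∈ f '' B, 0 < ‖y - c‖ := by
    intro y hy
    rw [norm_pos_iff, sub_ne_zero]
    rintro rfl
    exact hcS hy
  have hΦc : ContinuousOn Φ (f '' B) := by
    have h1 : ContinuousOn (fun y => ε / ‖y - c‖) (f '' B) :=
      continuousOn_const.div (by fun_prop) (fun y hy => (hne y hy).ne')
    have h2 : ContinuousOn (fun y => max (ε / ‖y - c‖) 1) (f '' B) := h1.sup continuousOn_const
    exact continuousOn_const.add (h2.smul (continuousOn_id.sub continuousOn_const))
  have hΦ1 : ∀ y ∈ f '' B, ε ≤ dist y c → Φ y = y := by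
    intro y hy h
    rw [dist_eq_norm] at h
    simp only [hΦ]
    rw [max_eq_right ((div_le_one (hne y hy)).2 h)]
    simp
  have hΦ2 : ∀ y ∈ f '' B, dist y c < ε → dist (Φ y) c = ε := by
    intro y hy h
    rw [dist_eq_norm] at h
    simp only [hΦ]
    rw [max_eq_left ((one_le_div (hne y hy)).2 h.le), dist_eq_norm, add_sub_cancel_left, norm_smul,
      Real.norm_of_nonneg (by positivity), div_mul_cancel₀ _ (hne y hy).ne']
  have hnz : ∀ y ∈ f '' B, p (Φ y) - v ≠ 0 := by
    intro y hy h0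
    rcases le_or_gt ε (dist y c) with h | h
    · rw [hΦ1 y hy h] at h0
      have h1 := hPG y
      rw [h0, sub_zero] at h1
      have h2 := hm y ⟨hy, h⟩
      linarith
    · exact hvn ⟨Φ y, hΦ2 y hy h, sub_eq_zero.1 h0⟩
  obtain ⟨x, hx, hfix⟩ := iod_brouwer (fun x => x - (p (Φ (f x)) - v)) (by
    refine continuousOn_id.sub (ContinuousOn.sub ?_ continuousOn_const)
    exact hpc.continuous.comp_continuousOn (hΦc.comp hf (mapsTo_image f B))) (by
    intro x hx
    have hy : f x ∈ f '' B := mem_image_of_mem f hx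
    have e1 : x - (p (Φ (f x)) - v) = G (f x) - (p (Φ (f x)) - v) := by rw [hG' x hx]
    rw [e1]
    rcases le_or_gt ε (dist (f x) c) with h | h
    · rw [hΦ1 _ hy h]
      linarith [hPG (f x)]
    · have h1 := hsm _ h.le
      have h2 := hsm _ (hΦ2 _ hy h).le
      have h3 := hPG (Φ (f x))
      have e2 : G (f x) - (p (Φ (f x)) - v) =
        G (f x) - G (Φ (f x)) + (G (Φ (f x)) - (p (Φ (f x)) - v)) := by abel
      rw [e2]
      have h4 := norm_add_le (G (f x) - G (Φ (f x))) (G (Φ (f x)) - (p (Φ (f x)) - v))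
      have h5 := norm_sub_le (G (f x)) (G (Φ (f x)))
      linarith)
  exact hnz (f x) (mem_image_of_mem f hx) (by simpa using hfix)

/-- Every boundary point of the maximal reach set `Ω₁(t;I₀) = ⋃_{d} φ(t;I₀,d)` is reached
from the boundary of the initial set. -/
theorem stmt7 {n : ℕ} {P : Type*} (I₀ : Set (EuclideanSpace ℝ (Fin n)))
    (hI : IsCompact I₀)
    (φ : EuclideanSpace ℝ (Fin n) → P → EuclideanSpace ℝ (Fin n))
    -- for each perturbation d, φ(·,d) is a homeomorphism of the compact set I₀ onto its image
    (hcont : ∀ d : P, ContinuousOn (fun x => φ x d) I₀)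
    (hinj : ∀ d : P, Set.InjOn (fun x => φ x d) I₀)
    (hΩ₁ : IsCompact (⋃ d : P, (fun x => φ x d) '' I₀)) :
    ∀ x ∈ frontier (⋃ d : P, (fun x => φ x d) '' I₀),
      ∃ x₀ ∈ frontier I₀, ∃ d : P, x = φ x₀ d := by
  intro x hx
  have hxm := hΩ₁.isClosed.frontier_subset hx
  obtain ⟨d, x₀, hx₀, rfl⟩ := mem_iUnion.1 hxm
  refine ⟨x₀, ⟨subset_closure hx₀, fun hint => hx.2 ?_⟩, d, rfl⟩
  obtain ⟨ρ, hρ, hsub⟩ := Metric.nhds_basis_closedBall.mem_iff.1 (mem_interior_iff_mem_nhds.1 hint)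
  have hmaps : MapsTo (fun z : EuclideanSpace ℝ (Fin n) => x₀ + ρ • z) (closedBall 0 1) I₀ := by
    intro z hz
    apply hsub
    have hz' : ‖z‖ ≤ 1 := by simpa using hz
    simp only [mem_closedBall, dist_self_add_left, norm_smul, Real.norm_of_nonneg hρ.le]
    nlinarith
  have hmain := iod_main (fun z => φ (x₀ + ρ • z) d)
    ((hcont d).comp (by fun_prop) hmaps)
    (fun a ha b hb hab => by
      have h1 := hinj d (hmaps ha) (hmaps hb) hab
      exact smul_right_injective _ hρ.ne' (add_left_cancel h1))
  simp only [smul_zero, add_zero] at hmain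
  refine interior_mono ?_ hmain
  rintro _ ⟨z, hz, rfl⟩
  exact mem_iUnion.2 ⟨d, x₀ + ρ • z, hmaps hz, rfl⟩
end
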